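/- Let (α, μ) be a finite measure space, hₙ : α → ℝ measurable with hₙ ≥ 0 μ-a.e., and h ∈ L¹(μ), and assume that ∫_α hₙ g dμ → ∫_α h g dμ as n → ∞ for every bounded measurable g : α → ℝ. Let gₙ, g : α → ℝ be measurable with gₙ → g μ-almost everywhere and 0 ≤ gₙ(x) ≤ M for all n and μ-a.e. x, for some constant M. Then liminf_{n→∞} ∫_α hₙ gₙ dμ ≥ ∫_α h g dμ. (This combination of weak L¹ convergence of a nonnegative sequence with an a.e.-convergent uniformly bounded multiplier is used in the paper to obtain the liminf inequality for the entropy production term (Sᵏ : Dvᵏ) φ / ϑᵏ.) -/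

import Mathlib

open MeasureTheory Filter
open scoped Topology

/-- If `v n → l` and `v` is bounded below, then the tail infima of `v` tend to `l`. -/
lemma tendsto_iInf_tail_of_tendsto {v : ℕ → ℝ} {l : ℝ} (hb : BddBelow (Set.range v))
    (hv : Tendsto v atTop (𝓝 l)) :
    Tendsto (fun k => ⨅ n, v (k + n)) atTop (𝓝 l) := by
  have hb' : ∀ k, BddBelow (Set.range fun n => v (k + n)) := fun k =>
    hb.mono (by rintro _ ⟨n, rfl⟩; exact ⟨k + n, rfl⟩)
  refine tendsto_order.2 ⟨fun a ha => ?_, fun a ha => ?_⟩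
  · obtain ⟨b, hab, hbl⟩ := exists_between ha
    obtain ⟨N, hN⟩ := eventually_atTop.1 (hv.eventually (lt_mem_nhds hbl))
    filter_upwards [eventually_ge_atTop N] with k hk
    exact hab.trans_le (le_ciInf fun n => (hN (k + n) (by omega)).le)
  · filter_upwards [hv.eventually (gt_mem_nhds ha)] with k hk
    exact (ciInf_le (hb' k) 0).trans_lt hk

lemma liminf_nonneg_of_forall_nonneg {u : ℕ → ℝ} (hu : ∀ n, 0 ≤ u n) : 0 ≤ liminf u atTop := by
  rw [liminf_eq]
  exact Real.sSup_nonneg' ⟨0, Eventually.of_forall hu, le_rfl⟩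

/-- Weak `L¹` convergence of a nonnegative sequence combined with an a.e.
convergent, uniformly bounded nonnegative multiplier: if `hₙ ≥ 0` a.e.,
`h ∈ L¹(μ)`, `∫ hₙ g → ∫ h g` for every bounded measurable `g`, and
`gₙ → g` a.e. with `0 ≤ gₙ ≤ M`, then `liminf_n ∫ hₙ gₙ dμ ≥ ∫ h g dμ`. -/
theorem liminf_weakL1_ae_bounded_multiplier
    {α : Type*} [MeasurableSpace α] {μ : Measure α} [IsFiniteMeasure μ]
    (h : ℕ → α → ℝ) (hlim : α → ℝ)
    (hmeas : ∀ n, Measurable (h n))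
    (hnonneg : ∀ n, ∀ᵐ x ∂μ, 0 ≤ h n x)
    (hlim_int : Integrable hlim μ)
    (hweak : ∀ g : α → ℝ, Measurable g → (∃ M : ℝ, ∀ x, |g x| ≤ M) →
      Tendsto (fun n => ∫ x, h n x * g x ∂μ) atTop (𝓝 (∫ x, hlim x * g x ∂μ)))
    (g : ℕ → α → ℝ) (glim : α → ℝ)
    (hgmeas : ∀ n, Measurable (g n)) (hglim : Measurable glim)
    (hg_ae : ∀ᵐ x ∂μ, Tendsto (fun n => g n x) atTop (𝓝 (glim x)))
    (M : ℝ) (hg_bound : ∀ n, ∀ᵐ x ∂μ, 0 ≤ g n x ∧ g n x ≤ M) :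
    ∫ x, hlim x * glim x ∂μ ≤ liminf (fun n => ∫ x, h n x * g n x ∂μ) atTop := by
  have hone := hweak (fun _ => 1) measurable_const ⟨1, by simp⟩
  simp only [mul_one] at hone
  by_cases hint : ∀ᶠ n in atTop, Integrable (h n) μ
  swap
  · -- the Bochner integrals of non-integrable functions vanish, which forces `hlim = 0`
    have hzero : ∫ x, hlim x ∂μ = 0 := by
      by_contra hne
      refine hint ((hone.eventually_ne hne).mono fun n hn => ?_)
      by_contra hn'
      exact hn (integral_undef hn')
    have hpos : 0 ≤ᵐ[μ] hlim := by
      refine ae_nonneg_of_forall_setIntegral_nonneg hlim_int fun s hs _ => ?_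
      have hind := hweak (s.indicator fun _ => 1) (measurable_const.indicator hs)
        ⟨1, fun x => by by_cases hx : x ∈ s <;> simp [hx]⟩
      have heq : ∫ x in s, hlim x ∂μ = ∫ x, hlim x * s.indicator (fun _ => 1) x ∂μ := by
        rw [← integral_indicator hs]
        congr 1 with x
        by_cases hx : x ∈ s <;> simp [hx]
      rw [heq]
      refine ge_of_tendsto' hind fun n => integral_nonneg_of_ae ?_
      filter_upwards [hnonneg n] with x hx
      exact mul_nonneg hx (Set.indicator_nonneg (fun _ _ => zero_le_one) x)
    have hae := (integral_eq_zero_iff_of_nonneg_ae hpos hlim_int).1 hzero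
    have hprod : ∫ x, hlim x * glim x ∂μ = 0 := by
      refine integral_eq_zero_of_ae ?_
      filter_upwards [hae] with x hx
      simp [hx]
    rw [hprod]
    refine liminf_nonneg_of_forall_nonneg fun n => integral_nonneg_of_ae ?_
    filter_upwards [hnonneg n, hg_bound n] with x hx hgx
    exact mul_nonneg hx hgx.1
  · set c : ℕ → α → ℝ := fun n x => max 0 (min (g n x) M) with hc
    have hc_nonneg : ∀ n x, 0 ≤ c n x := fun n x => le_max_left _ _
    have hc_le : ∀ n x, c n x ≤ |M| := fun n x =>
      max_le (abs_nonneg M) ((min_le_right _ _).trans (le_abs_self M))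
    have hc_eq : ∀ᵐ x ∂μ, ∀ n, c n x = g n x := by
      filter_upwards [ae_all_iff.2 hg_bound] with x hx n
      simp [hc, hx n]
    have hbdd : ∀ k x, BddBelow (Set.range fun n => c (k + n) x) := fun k x =>
      ⟨0, by rintro _ ⟨n, rfl⟩; exact hc_nonneg _ _⟩
    set G : ℕ → α → ℝ := fun k x => ⨅ n, c (k + n) x with hG
    have hG_meas : ∀ k, Measurable (G k) := fun k =>
      Measurable.iInf fun n => measurable_const.max ((hgmeas _).min measurable_const)
    have hG_le : ∀ k n x, k ≤ n → G k x ≤ c n x := fun k n x hkn => by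
      simpa [Nat.add_sub_cancel' hkn] using ciInf_le (hbdd k x) (n - k)
    have hG_abs : ∀ k x, |G k x| ≤ |M| := fun k x => by
      rw [abs_of_nonneg (le_ciInf fun n => hc_nonneg _ _)]
      exact (hG_le k k x le_rfl).trans (hc_le k x)
    have hprod_int : ∀ n, Integrable (h n) μ → Integrable (fun x => h n x * g n x) μ :=
      fun n hn => hn.mul_bdd (c := |M|) (hgmeas n).aestronglyMeasurable (by
        filter_upwards [hc_eq] with x hx
        rw [← hx n, Real.norm_of_nonneg (hc_nonneg n x)]
        exact hc_le n x)
    have hcobdd : IsCoboundedUnder (· ≥ ·) atTop (fun n => ∫ x, h n x * g n x ∂μ) := by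
      refine ((hone.mul_const |M|).isBoundedUnder_le.mono_le ?_).isCoboundedUnder_ge
      filter_upwards [hint] with n hn
      rw [← integral_mul_const]
      refine integral_mono_ae (hprod_int n hn) (hn.mul_const _) ?_
      filter_upwards [hnonneg n, hc_eq] with x hx hcx
      exact mul_le_mul_of_nonneg_left (hcx n ▸ hc_le n x) hx
    have hstep : ∀ k, ∫ x, hlim x * G k x ∂μ ≤
        liminf (fun n => ∫ x, h n x * g n x ∂μ) atTop := fun k => by
      refine le_of_forall_lt fun a ha => ?_
      obtain ⟨b, hab, hb⟩ := exists_between ha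
      refine hab.trans_le (le_liminf_of_le hcobdd ?_)
      filter_upwards [(hweak (G k) (hG_meas k) ⟨|M|, hG_abs k⟩).eventually (lt_mem_nhds hb),
        hint, eventually_ge_atTop k] with n hbn hn hkn
      refine hbn.le.trans (integral_mono_ae
        (hn.mul_bdd (hG_meas k).aestronglyMeasurable (Eventually.of_forall (hG_abs k)))
        (hprod_int n hn) ?_)
      filter_upwards [hnonneg n, hc_eq] with x hx hcx
      exact mul_le_mul_of_nonneg_left (hcx n ▸ hG_le k n x hkn) hx
    have htend : Tendsto (fun k => ∫ x, hlim x * G k x ∂μ) atTop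
        (𝓝 (∫ x, hlim x * glim x ∂μ)) := by
      refine tendsto_integral_of_dominated_convergence (fun x => |hlim x| * |M|)
        (fun k => hlim_int.aestronglyMeasurable.mul (hG_meas k).aestronglyMeasurable)
        (hlim_int.abs.mul_const _) (fun k => Eventually.of_forall fun x => ?_) ?_
      · rw [Real.norm_eq_abs, abs_mul]
        exact mul_le_mul_of_nonneg_left (hG_abs k x) (abs_nonneg _)
      · filter_upwards [hg_ae, hc_eq] with x hx hcx
        refine (tendsto_iInf_tail_of_tendsto (v := fun n => c n x) ?_ ?_).const_mul (hlim x)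
        · exact ⟨0, by rintro _ ⟨n, rfl⟩; exact hc_nonneg _ _⟩
        · simpa only [hcx] using hx
    exact le_of_tendsto' htend hstep
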